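/- Let k > 0, let φ : ℝ² → ℂ be a bounded measurable function with compact support, and let b < 0. Define the double-layer potential w_b : ℝ² → ℂ by w_b(x₁, x₂) = − ∫_{ℝ²} K_b(x₁ − y₁, x₂ − y₂) φ(y₁, y₂) dy₁ dy₂, where K_b(z₁, z₂) = b (1 − i k r) e^{i k r} / (2π r³) with r = √(z₁² + z₂² + b²). Then for every Schwartz function ψ : ℝ² → ℂ, the function (x₁,x₂) ↦ w_b(x₁,x₂) Ψ(x₁,x₂) is integrable on ℝ², the function (v₁,v₂) ↦ φ̂(v₁,v₂) e^{−i κ(v₁,v₂) b} ψ(v₁,v₂) is integrable on ℝ², and ∫_{ℝ²} w_b(x₁,x₂) Ψ(x₁,x₂) dx₁ dx₂ = ∫_{ℝ²} φ̂(v₁,v₂) e^{−i κ(v₁,v₂) b} ψ(v₁,v₂) dv₁ dv₂. (That is, the tempered-distribution Fourier transform of the double-layer potential with density φ, evaluated on the plane {x₃ = b}, equals φ̂(v) e^{−iκ(v) b}.) -/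

import Mathlib

open MeasureTheory

/-- `κ(v) = √(k² − |v|²)` for `|v|² ≤ k²` and `κ(v) = i √(|v|² − k²)` for `|v|² > k²`. -/
noncomputable def kappa (k : ℝ) (v : ℝ × ℝ) : ℂ :=
  if v.1 ^ 2 + v.2 ^ 2 ≤ k ^ 2 then (Real.sqrt (k ^ 2 - v.1 ^ 2 - v.2 ^ 2) : ℂ)
  else Complex.I * (Real.sqrt (v.1 ^ 2 + v.2 ^ 2 - k ^ 2) : ℂ)

/-- The double-layer (normal-derivative) kernel
`K_b(z₁,z₂) = b (1 − i k r) e^{ikr} / (2π r³)` with `r = √(z₁² + z₂² + b²)`. -/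
noncomputable def Kker (k b : ℝ) (z : ℝ × ℝ) : ℂ :=
  (b : ℂ) * (1 - Complex.I * (k : ℂ) * (Real.sqrt (z.1 ^ 2 + z.2 ^ 2 + b ^ 2) : ℂ)) *
    Complex.exp (Complex.I * (k : ℂ) * (Real.sqrt (z.1 ^ 2 + z.2 ^ 2 + b ^ 2) : ℂ)) /
    (2 * (Real.pi : ℂ) * (Real.sqrt (z.1 ^ 2 + z.2 ^ 2 + b ^ 2) : ℂ) ^ 3)

/-- The double-layer potential with density `φ`, restricted to the plane `{x₃ = b}`. -/
noncomputable def doubleLayer (k b : ℝ) (φ : ℝ × ℝ → ℂ) (x : ℝ × ℝ) : ℂ :=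
  -∫ y : ℝ × ℝ, Kker k b (x.1 - y.1, x.2 - y.2) * φ y

/-- The Fourier transform (with kernel `e^{-ix·v}`) of an integrable function `φ`. -/
noncomputable def fourierT (φ : ℝ × ℝ → ℂ) (v : ℝ × ℝ) : ℂ :=
  ∫ x : ℝ × ℝ, φ x * Complex.exp (-Complex.I * ((x.1 * v.1 + x.2 * v.2 : ℝ) : ℂ))

/-- `Ψ(x) = ∫ ψ(v) e^{-i x·v} dv`, the (kernel `e^{-ix·v}`) Fourier transform of the
Schwartz function `ψ`. -/
noncomputable def BigPsi (ψ : SchwartzMap (ℝ × ℝ) ℂ) (x : ℝ × ℝ) : ℂ :=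
  ∫ v : ℝ × ℝ, ψ v * Complex.exp (-Complex.I * ((x.1 * v.1 + x.2 * v.2 : ℝ) : ℂ))

open Filter Topology


lemma ftc_Ioi {g g' : ℝ → ℝ} {m l : ℝ} (hd : ∀ x ∈ Set.Ioi (0:ℝ), HasDerivAt g (g' x) x)
    (hn : ∀ x ∈ Set.Ioi (0:ℝ), 0 ≤ g' x) (h0 : Tendsto g (𝓝[>] 0) (𝓝 m))
    (h1 : Tendsto g atTop (𝓝 l)) :
    IntegrableOn g' (Set.Ioi 0) ∧ ∫ x in Set.Ioi (0:ℝ), g' x = l - m := by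
  have hc : ContinuousWithinAt (Function.update g 0 m) (Set.Ici 0) 0 := by
    rw [continuousWithinAt_update_same]
    have : Set.Ici (0:ℝ) \ {0} = Set.Ioi 0 := by ext x; simp [lt_iff_le_and_ne, eq_comm]
    rwa [this]
  have hd' : ∀ x ∈ Set.Ioi (0:ℝ), HasDerivAt (Function.update g 0 m) (g' x) x := by
    intro x hx
    refine (hd x hx).congr_of_eventuallyEq ?_
    filter_upwards [lt_mem_nhds hx] with y hy
    exact Function.update_of_ne (ne_of_gt hy) _ _
  have h1' : Tendsto (Function.update g 0 m) atTop (𝓝 l) := by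
    refine h1.congr' ?_
    filter_upwards [eventually_gt_atTop 0] with y hy
    exact (Function.update_of_ne (ne_of_gt hy) _ _).symm
  refine ⟨integrableOn_Ioi_deriv_of_nonneg hc hd' hn h1', ?_⟩
  rw [integral_Ioi_of_hasDerivAt_of_nonneg hc hd' hn h1']
  simp

noncomputable def erfE (x : ℝ) : ℝ := ∫ y in (0:ℝ)..x, Real.exp (-y ^ 2)

lemma erfE_deriv (x : ℝ) : HasDerivAt erfE (Real.exp (-x ^ 2)) x := by
  have hc : Continuous fun y : ℝ => Real.exp (-y ^ 2) := by fun_prop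
  exact intervalIntegral.integral_hasDerivAt_right (hc.intervalIntegrable _ _)
    (hc.stronglyMeasurableAtFilter _ _) hc.continuousAt

lemma erfE_top : Tendsto erfE atTop (𝓝 (Real.sqrt Real.pi / 2)) := by
  have h := integral_gaussian_Ioi 1
  have hi := integrable_exp_neg_mul_sq (b := 1) one_pos
  simp only [neg_mul, one_mul, div_one] at h hi
  rw [← h]
  exact intervalIntegral_tendsto_integral_Ioi 0 hi.integrableOn tendsto_id

lemma erfE_neg (x : ℝ) : erfE (-x) = - erfE x := by
  unfold erfE
  have := intervalIntegral.integral_comp_neg (a := 0) (b := x) (fun y => Real.exp (-y ^ 2))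
  simp only [neg_sq, neg_zero] at this
  rw [this, intervalIntegral.integral_symm]
  

lemma erfE_bot : Tendsto erfE atBot (𝓝 (-(Real.sqrt Real.pi / 2))) := by
  have := (erfE_top.comp tendsto_neg_atBot_atTop).neg
  refine this.congr fun x => ?_
  simp [erfE_neg]

noncomputable def ff (a s u : ℝ) : ℝ := Real.exp (-(a ^ 2 * u ^ 2) - s ^ 2 / (4 * u ^ 2))

set_option linter.unusedVariables false

lemma al_top {a s : ℝ} (ha : 0 < a) (hs : 0 < s) : Tendsto (fun u : ℝ => a * u - s / (2 * u)) atTop atTop := by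
  have h1 : Tendsto (fun u : ℝ => a * u) atTop atTop := tendsto_id.const_mul_atTop ha
  have h2 : Tendsto (fun u : ℝ => s / (2 * u)) atTop (𝓝 0) :=
    tendsto_const_nhds.div_atTop (tendsto_id.const_mul_atTop two_pos)
  simpa [sub_eq_add_neg] using h1.atTop_add h2.neg

lemma be_top {a s : ℝ} (ha : 0 < a) (hs : 0 < s) : Tendsto (fun u : ℝ => a * u + s / (2 * u)) atTop atTop := by
  have h1 : Tendsto (fun u : ℝ => a * u) atTop atTop := tendsto_id.const_mul_atTop ha
  have h2 : Tendsto (fun u : ℝ => s / (2 * u)) atTop (𝓝 0) :=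
    tendsto_const_nhds.div_atTop (tendsto_id.const_mul_atTop two_pos)
  exact h1.atTop_add h2

lemma au_zero {a s : ℝ} (ha : 0 < a) (hs : 0 < s) : Tendsto (fun u : ℝ => a * u) (𝓝[>] 0) (𝓝 0) := by
  have : Tendsto (fun u : ℝ => a * u) (𝓝 0) (𝓝 (a * 0)) := by
    exact (continuous_const.mul continuous_id).tendsto 0
  rw [mul_zero] at this
  exact this.mono_left nhdsWithin_le_nhds

lemma su_zero {a s : ℝ} (ha : 0 < a) (hs : 0 < s) : Tendsto (fun u : ℝ => s / (2 * u)) (𝓝[>] 0) atTop := by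
  have := (tendsto_inv_nhdsGT_zero (𝕜 := ℝ)).const_mul_atTop (half_pos hs)
  refine this.congr fun u => ?_
  by_cases h : u = 0
  · simp [h]
  · field_simp

lemma al_zero {a s : ℝ} (ha : 0 < a) (hs : 0 < s) : Tendsto (fun u : ℝ => a * u - s / (2 * u)) (𝓝[>] 0) atBot := by
  have := (au_zero ha hs).add_atBot (tendsto_neg_atTop_atBot.comp (su_zero ha hs))
  simpa [sub_eq_add_neg] using this

lemma be_zero {a s : ℝ} (ha : 0 < a) (hs : 0 < s) : Tendsto (fun u : ℝ => a * u + s / (2 * u)) (𝓝[>] 0) atTop := 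
  (au_zero ha hs).add_atTop (su_zero ha hs)

lemma inv_deriv {a s : ℝ} (ha : 0 < a) (hs : 0 < s) {u : ℝ} (hu : 0 < u) :
    HasDerivAt (fun u : ℝ => s / (2 * u)) (- (s / (2 * u ^ 2))) u := by
  have := ((hasDerivAt_inv hu.ne').const_mul (s / 2))
  refine (this.congr_of_eventuallyEq ?_).congr_deriv ?_
  · filter_upwards [lt_mem_nhds hu] with y hy
    field_simp
  · field_simp

lemma dA {a s : ℝ} (ha : 0 < a) (hs : 0 < s) {u : ℝ} (hu : 0 < u) :
    HasDerivAt (fun u : ℝ => Real.exp (-(a * s)) * erfE (a * u - s / (2 * u)))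
      (ff a s u * (a + s / (2 * u ^ 2))) u := by
  have h1 : HasDerivAt (fun u : ℝ => a * u - s / (2 * u)) (a + s / (2 * u ^ 2)) u := by
    have := ((hasDerivAt_id u).const_mul a).sub (inv_deriv ha hs hu)
    refine this.congr_deriv (by ring)
  refine (((erfE_deriv _).comp u h1).const_mul (Real.exp (-(a * s)))).congr_deriv ?_
  rw [← mul_assoc, ← Real.exp_add]
  unfold ff
  congr 2
  field_simp
  ring

lemma dB {a s : ℝ} (ha : 0 < a) (hs : 0 < s) {u : ℝ} (hu : 0 < u) :
    HasDerivAt (fun u : ℝ => Real.exp (a * s) * erfE (a * u + s / (2 * u)))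
      (ff a s u * (a - s / (2 * u ^ 2))) u := by
  have h1 : HasDerivAt (fun u : ℝ => a * u + s / (2 * u)) (a - s / (2 * u ^ 2)) u := by
    have := ((hasDerivAt_id u).const_mul a).add (inv_deriv ha hs hu)
    refine this.congr_deriv (by ring)
  refine (((erfE_deriv _).comp u h1).const_mul (Real.exp (a * s))).congr_deriv ?_
  rw [← mul_assoc, ← Real.exp_add]
  unfold ff
  congr 2
  field_simp
  ring

lemma dff {a s : ℝ} (ha : 0 < a) (hs : 0 < s) {u : ℝ} (hu : 0 < u) :
    HasDerivAt (fun u : ℝ => u * ff a s u)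
      (ff a s u + (- 2 * a ^ 2 * u ^ 2 + s ^ 2 / (2 * u ^ 2)) * ff a s u) u := by
  have h1 : HasDerivAt (fun u : ℝ => -(a ^ 2 * u ^ 2) - s ^ 2 / (4 * u ^ 2))
      (-(2 * a ^ 2 * u) + s ^ 2 / (2 * u ^ 3)) u := by
    have h2 := (((hasDerivAt_pow 2 u).const_mul (a ^ 2)).neg).sub
      ((((hasDerivAt_pow 2 u).fun_inv (by positivity))).const_mul (s ^ 2 / 4))
    refine (h2.congr_of_eventuallyEq ?_).congr_deriv ?_
    · filter_upwards [lt_mem_nhds hu] with y hy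
      simp only [Pi.sub_apply, Pi.neg_apply]
      field_simp
    · field_simp
      ring
  refine ((hasDerivAt_id u).mul h1.exp).congr_deriv ?_
  simp only [ff, id]
  field_simp

lemma ff_top {a s : ℝ} (ha : 0 < a) (hs : 0 < s) : Tendsto (fun u : ℝ => u * ff a s u) atTop (𝓝 0) := by
  have h : Tendsto (fun u : ℝ => u * Real.exp (-(a^2 * u))) atTop (𝓝 0) := by
    have := Real.tendsto_pow_mul_exp_neg_atTop_nhds_zero 1
    have h2 := (this.comp (tendsto_id.const_mul_atTop (show 0 < a^2 by positivity))).const_mul ((a^2)⁻¹)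
    rw [mul_zero] at h2
    refine h2.congr fun u => ?_
    simp
    field_simp
  refine squeeze_zero' ?_ ?_ h
  · filter_upwards [eventually_gt_atTop 0] with u hu
    unfold ff; positivity
  · filter_upwards [eventually_gt_atTop 1] with u hu
    unfold ff
    have : 0 ≤ s ^ 2 / (4 * u ^ 2) := by positivity
    have h3 : a ^ 2 * u ≤ a ^ 2 * u ^ 2 := by
      apply mul_le_mul_of_nonneg_left _ (by positivity); nlinarith
    gcongr
    linarith

lemma ff_zero {a s : ℝ} (ha : 0 < a) (hs : 0 < s) : Tendsto (fun u : ℝ => u * ff a s u) (𝓝[>] 0) (𝓝 0) := by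
  have h : Tendsto (fun u : ℝ => u) (𝓝[>] 0) (𝓝 0) := tendsto_nhdsWithin_of_tendsto_nhds tendsto_id
  refine squeeze_zero' ?_ ?_ h
  · filter_upwards [self_mem_nhdsWithin] with u hu
    have : 0 < u := hu
    unfold ff; positivity
  · filter_upwards [self_mem_nhdsWithin] with u hu
    have : 0 < u := hu
    have h1 : ff a s u ≤ 1 := by
      unfold ff
      rw [Real.exp_le_one_iff]
      have : 0 ≤ s ^ 2 / (4 * u ^ 2) := by positivity
      have : 0 ≤ a ^ 2 * u ^ 2 := by positivity
      linarith
    nlinarith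

lemma int_ff {a s : ℝ} (ha : 0 < a) (hs : 0 < s) : IntegrableOn (ff a s) (Set.Ioi 0) ∧
    ∫ u in Set.Ioi (0:ℝ), ff a s u = Real.sqrt Real.pi / (2 * a) * Real.exp (-(a * s)) := by
  have h := ftc_Ioi (g := fun u => (2 * a)⁻¹ * (Real.exp (-(a * s)) * erfE (a * u - s / (2 * u))
    + Real.exp (a * s) * erfE (a * u + s / (2 * u)))) (g' := ff a s)
    (fun u hu => (((dA ha hs hu).add (dB ha hs hu)).const_mul _).congr_deriv (by
      field_simp; ring))
    (fun u hu => by unfold ff; positivity)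
    ((((erfE_bot.comp (al_zero ha hs)).const_mul _).add ((erfE_top.comp (be_zero ha hs)).const_mul _)).const_mul _)
    ((((erfE_top.comp (al_top ha hs)).const_mul _).add ((erfE_top.comp (be_top ha hs)).const_mul _)).const_mul _)
  refine ⟨h.1, h.2.trans ?_⟩
  field_simp
  ring

lemma int_ff2 {a s : ℝ} (ha : 0 < a) (hs : 0 < s) : IntegrableOn (fun u => u ^ 2 * ff a s u) (Set.Ioi 0) ∧
    ∫ u in Set.Ioi (0:ℝ), u ^ 2 * ff a s u =
      Real.sqrt Real.pi * (1 + a * s) / (4 * a ^ 3) * Real.exp (-(a * s)) := by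
  have h := ftc_Ioi (g := fun u => (2 * a ^ 2)⁻¹ * ((2 * a)⁻¹ * (Real.exp (-(a * s)) * erfE (a * u - s / (2 * u))
    + Real.exp (a * s) * erfE (a * u + s / (2 * u))) + (s / 2) * (Real.exp (-(a * s)) * erfE (a * u - s / (2 * u))
    - Real.exp (a * s) * erfE (a * u + s / (2 * u))) - u * ff a s u)) (g' := fun u => u ^ 2 * ff a s u)
    (fun u hu => ((((((dA ha hs hu).add (dB ha hs hu)).const_mul _).add
      (((dA ha hs hu).sub (dB ha hs hu)).const_mul _)).sub (dff ha hs hu)).const_mul _).congr_deriv (by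
      have : 0 < u := hu
      field_simp; ring))
    (fun u hu => by unfold ff; positivity)
    ((((((((erfE_bot.comp (al_zero ha hs)).const_mul _).add ((erfE_top.comp (be_zero ha hs)).const_mul _)).const_mul _)).add
      (((((erfE_bot.comp (al_zero ha hs)).const_mul _).sub ((erfE_top.comp (be_zero ha hs)).const_mul _)).const_mul _))).sub (ff_zero ha hs)).const_mul _)
    ((((((((erfE_top.comp (al_top ha hs)).const_mul _).add ((erfE_top.comp (be_top ha hs)).const_mul _)).const_mul _)).add
      (((((erfE_top.comp (al_top ha hs)).const_mul _).sub ((erfE_top.comp (be_top ha hs)).const_mul _)).const_mul _))).sub (ff_top ha hs)).const_mul _)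
  refine ⟨h.1, h.2.trans ?_⟩
  field_simp
  ring

noncomputable def rr (a : ℝ) (z : ℝ × ℝ) : ℝ := Real.sqrt (z.1 ^ 2 + z.2 ^ 2 + a ^ 2)

noncomputable def GG (a : ℝ) (s : ℂ) (z : ℝ × ℝ) : ℂ :=
  (a : ℂ) * (1 + s * (rr a z : ℂ)) * Complex.exp (-s * (rr a z : ℂ)) /
    (2 * (Real.pi : ℂ) * (rr a z : ℂ) ^ 3)

noncomputable def ee (z v : ℝ × ℝ) : ℂ :=
  Complex.exp (-Complex.I * ((z.1 * v.1 + z.2 * v.2 : ℝ) : ℂ))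

lemma norm_ee (z v : ℝ × ℝ) : ‖ee z v‖ = 1 := by
  unfold ee
  rw [Complex.norm_exp]
  simp

lemma continuous_ee : Continuous (fun p : (ℝ × ℝ) × (ℝ × ℝ) => ee p.1 p.2) := by
  unfold ee; fun_prop

noncomputable def HH (a s u : ℝ) (z : ℝ × ℝ) : ℝ :=
  (2 * a / (Real.pi * Real.sqrt Real.pi)) * (u ^ 2 * ff a s u) *
    (Real.exp (-u ^ 2 * z.1 ^ 2) * Real.exp (-u ^ 2 * z.2 ^ 2))

lemma rr_pos {a : ℝ} (ha : 0 < a) (z : ℝ × ℝ) : 0 < rr a z := by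
  unfold rr; positivity

lemma HH_nonneg {a : ℝ} (ha : 0 < a) (s u : ℝ) (z : ℝ × ℝ) : 0 ≤ HH a s u z := by
  unfold HH ff; positivity

lemma HH_eq (a s u : ℝ) (z : ℝ × ℝ) :
    HH a s u z = (2 * a / (Real.pi * Real.sqrt Real.pi)) * (u ^ 2 * ff (rr a z) s u) := by
  have h : rr a z ^ 2 = z.1 ^ 2 + z.2 ^ 2 + a ^ 2 := Real.sq_sqrt (by positivity)
  unfold HH ff
  rw [h, mul_assoc, mul_assoc, ← Real.exp_add, ← Real.exp_add]
  ring_nf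

lemma HH_int_u {a s : ℝ} (ha : 0 < a) (hs : 0 < s) (z : ℝ × ℝ) :
    ∫ u in Set.Ioi (0:ℝ), (HH a s u z : ℂ) = GG a s z := by
  rw [integral_complex_ofReal]
  simp_rw [HH_eq, integral_const_mul]
  rw [(int_ff2 (rr_pos ha z) hs).2]
  unfold GG
  have h2 := rr_pos ha z
  have h3 : (rr a z : ℂ) ≠ 0 := by exact_mod_cast h2.ne'
  have h4 : (Real.pi : ℂ) ≠ 0 := by exact_mod_cast Real.pi_ne_zero
  have h5 : (Real.sqrt Real.pi : ℂ) ≠ 0 := by exact_mod_cast (Real.sqrt_pos.2 Real.pi_pos).ne'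
  push_cast
  rw [show -(s:ℂ) * (rr a z : ℂ) = -((rr a z : ℂ) * s) by ring]
  field_simp
  ring

lemma gauss2 {u : ℝ} (hu : 0 < u) :
    Integrable (fun z : ℝ × ℝ => Real.exp (-u ^ 2 * z.1 ^ 2) * Real.exp (-u ^ 2 * z.2 ^ 2)) ∧
    ∫ z : ℝ × ℝ, Real.exp (-u ^ 2 * z.1 ^ 2) * Real.exp (-u ^ 2 * z.2 ^ 2) = Real.pi / u ^ 2 := by
  have hi := integrable_exp_neg_mul_sq (b := u ^ 2) (by positivity)
  refine ⟨hi.mul_prod hi, ?_⟩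
  rw [Measure.volume_eq_prod]
  rw [integral_prod_mul (fun x : ℝ => Real.exp (-u ^ 2 * x ^ 2)) (fun x : ℝ => Real.exp (-u ^ 2 * x ^ 2)),
    integral_gaussian, Real.mul_self_sqrt (by positivity)]

lemma gauss1F {u : ℝ} (hu : 0 < u) (v : ℝ) :
    ∫ x : ℝ, Complex.exp (-(u:ℂ) ^ 2 * (x:ℂ) ^ 2) * Complex.exp (-Complex.I * (x * v)) =
      ((Real.sqrt (Real.pi / u ^ 2) : ℝ) : ℂ) * Complex.exp (-(v:ℂ) ^ 2 / (4 * (u:ℂ)^2)) := by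
  have h := fourierIntegral_gaussian (b := ((u:ℂ) ^ 2)) (by
    rw [← Complex.ofReal_pow, Complex.ofReal_re]; positivity) (-(v:ℂ))
  rw [Real.sqrt_eq_rpow, Complex.ofReal_cpow (by positivity)]
  push_cast
  rw [neg_sq] at h
  rw [← h]
  congr 1
  ext x
  rw [mul_comm]
  congr 2
  ring

lemma gauss2F {u : ℝ} (hu : 0 < u) (v : ℝ × ℝ) :
    ∫ z : ℝ × ℝ, ((Real.exp (-u ^ 2 * z.1 ^ 2) * Real.exp (-u ^ 2 * z.2 ^ 2) : ℝ) : ℂ) * ee z v =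
      ((Real.pi / u ^ 2 * Real.exp (-(v.1 ^ 2 + v.2 ^ 2) / (4 * u ^ 2)) : ℝ) : ℂ) := by
  have h := integral_prod_mul (μ := (volume : Measure ℝ)) (ν := (volume : Measure ℝ))
    (fun x : ℝ => Complex.exp (-(u:ℂ) ^ 2 * (x:ℂ) ^ 2) * Complex.exp (-Complex.I * (x * v.1)))
    (fun x : ℝ => Complex.exp (-(u:ℂ) ^ 2 * (x:ℂ) ^ 2) * Complex.exp (-Complex.I * (x * v.2)))
  rw [gauss1F hu, gauss1F hu, ← Measure.volume_eq_prod] at h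
  calc _ = _ := by
        congr 1
        ext z
        unfold ee
        push_cast
        rw [mul_add, Complex.exp_add]
        ring
    _ = _ := h
    _ = _ := by
        have h1 : ((Real.sqrt (Real.pi / u ^ 2) : ℝ) : ℂ) * ((Real.sqrt (Real.pi / u ^ 2) : ℝ) : ℂ)
          = Real.pi / u ^ 2 := by
          rw [← Complex.ofReal_mul, Real.mul_self_sqrt (by positivity)]; push_cast; rfl
        rw [mul_mul_mul_comm, h1, ← Complex.exp_add]
        push_cast
        congr 2
        ring

lemma HH_integrable {a s : ℝ} (ha : 0 < a) (hs : 0 < s) :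
    Integrable (fun p : ℝ × (ℝ × ℝ) => HH a s p.1 p.2)
      ((volume.restrict (Set.Ioi 0)).prod volume) := by
  have hm : Measurable (fun p : ℝ × (ℝ × ℝ) => HH a s p.1 p.2) := by
    unfold HH ff; fun_prop
  rw [integrable_prod_iff hm.aestronglyMeasurable]
  constructor
  · filter_upwards [ae_restrict_mem measurableSet_Ioi] with u hu
    exact (gauss2 hu).1.const_mul _
  · refine ((int_ff ha hs).1.const_mul (2 * a / Real.sqrt Real.pi)).congr ?_
    filter_upwards [ae_restrict_mem measurableSet_Ioi] with u hu
    have : 0 < u := hu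
    simp_rw [Real.norm_of_nonneg (HH_nonneg ha _ _ _)]
    unfold HH
    rw [integral_const_mul, (gauss2 hu).2]
    field_simp

lemma GG_integrable {a s : ℝ} (ha : 0 < a) (hs : 0 < s) : Integrable (GG a s) := by
  have := (HH_integrable ha hs).ofReal (𝕜 := ℂ).integral_prod_right
  refine this.congr (Eventually.of_forall fun z => ?_)
  exact HH_int_u ha hs z

lemma GG_fourier {a s : ℝ} (ha : 0 < a) (hs : 0 < s) (v : ℝ × ℝ) :
    ∫ z, GG a s z * ee z v =
      ((Real.exp (-(a * Real.sqrt (v.1 ^ 2 + v.2 ^ 2 + s ^ 2))) : ℝ) : ℂ) := by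
  have hI : Integrable (Function.uncurry fun (u : ℝ) (z : ℝ × ℝ) => (HH a s u z : ℂ) * ee z v)
      ((volume.restrict (Set.Ioi 0)).prod volume) := by
    refine (HH_integrable ha hs).ofReal (𝕜 := ℂ).mul_bdd (c := 1) ?_ ?_
    · have : Continuous fun p : ℝ × (ℝ × ℝ) => ee p.2 v :=
        continuous_ee.comp (continuous_snd.prodMk continuous_const)
      exact this.aestronglyMeasurable
    · exact Eventually.of_forall fun p => (norm_ee _ _).le
  have hq : 0 < Real.sqrt (v.1 ^ 2 + v.2 ^ 2 + s ^ 2) := by positivity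
  calc ∫ z, GG a s z * ee z v = ∫ z, ∫ u in Set.Ioi (0:ℝ), (HH a s u z : ℂ) * ee z v := by
        congr 1; ext z
        rw [integral_mul_const, HH_int_u ha hs]
    _ = ∫ u in Set.Ioi (0:ℝ), ∫ z, (HH a s u z : ℂ) * ee z v := (integral_integral_swap hI).symm
    _ = ∫ u in Set.Ioi (0:ℝ), ((2 * a / Real.sqrt Real.pi *
          ff a (Real.sqrt (v.1 ^ 2 + v.2 ^ 2 + s ^ 2)) u : ℝ) : ℂ) := by
        refine setIntegral_congr_fun measurableSet_Ioi fun u hu => ?_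
        have hu : 0 < u := hu
        have : ∀ z, (HH a s u z : ℂ) * ee z v =
          ((2 * a / (Real.pi * Real.sqrt Real.pi) * (u ^ 2 * ff a s u) : ℝ) : ℂ) *
          (((Real.exp (-u ^ 2 * z.1 ^ 2) * Real.exp (-u ^ 2 * z.2 ^ 2) : ℝ) : ℂ) * ee z v) := by
          intro z; unfold HH; push_cast; ring
        simp_rw [this]
        rw [integral_const_mul, gauss2F hu, ← Complex.ofReal_mul]
        congr 1
        have : ff a (Real.sqrt (v.1 ^ 2 + v.2 ^ 2 + s ^ 2)) u =
          ff a s u * Real.exp (-(v.1 ^ 2 + v.2 ^ 2) / (4 * u ^ 2)) := by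
          unfold ff
          rw [Real.sq_sqrt (by positivity), ← Real.exp_add]
          congr 1; ring
        rw [this]
        field_simp
    _ = _ := by
        rw [integral_complex_ofReal, integral_const_mul, (int_ff ha hq).2]
        congr 1
        field_simp

lemma real_identity {a s : ℝ} (ha : 0 < a) (hs : 0 < s) {h : ℝ × ℝ → ℂ} (hh : Integrable h) :
    ∫ z, GG a s z * ∫ v, h v * ee z v =
    ∫ v, ((Real.exp (-(a * Real.sqrt (v.1 ^ 2 + v.2 ^ 2 + s ^ 2))) : ℝ) : ℂ) * h v := by
  have hI : Integrable (Function.uncurry fun (z v : ℝ × ℝ) => GG a s z * h v * ee z v)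
      (volume.prod volume) := by
    refine ((GG_integrable ha hs).mul_prod hh).mul_bdd (c := 1) ?_ ?_
    · exact continuous_ee.aestronglyMeasurable
    · exact Eventually.of_forall fun p => (norm_ee _ _).le
  calc _ = ∫ z, ∫ v, GG a s z * h v * ee z v := by
        congr 1; ext z
        rw [← integral_const_mul]
        simp_rw [mul_assoc]
    _ = ∫ v, ∫ z, GG a s z * h v * ee z v := integral_integral_swap hI
    _ = _ := by
        congr 1; ext v
        rw [← GG_fourier ha hs, ← integral_mul_const]
        congr 1; ext z; ring


noncomputable def SS (x : ℂ) : ℂ := Complex.exp (Complex.log x / 2)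

noncomputable def MM (a : ℝ) (s : ℂ) (v : ℝ × ℝ) : ℂ :=
  Complex.exp (-(a : ℂ) * SS (((v.1 ^ 2 + v.2 ^ 2 : ℝ) : ℂ) + s ^ 2))

lemma SS_re (x : ℂ) : 0 ≤ (SS x).re := by
  unfold SS
  rw [Complex.exp_re]
  refine mul_nonneg (Real.exp_pos _).le (Real.cos_nonneg_of_mem_Icc ?_)
  have h1 := Complex.neg_pi_lt_arg x
  have h2 := Complex.arg_le_pi x
  have h3 : (Complex.log x / 2).im = x.arg / 2 := by
    rw [← Complex.log_im]; simp
  rw [h3]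
  constructor <;> linarith

lemma SS_norm {x : ℂ} (hx : x ≠ 0) : ‖SS x‖ = Real.sqrt ‖x‖ := by
  unfold SS
  have : (Complex.log x / 2).re = Real.log ‖x‖ / 2 := by
    rw [← Complex.log_re]; simp
  rw [Complex.norm_exp, this, Real.exp_half, Real.exp_log (norm_pos_iff.2 hx)]

lemma SS_ofReal {x : ℝ} (hx : 0 < x) : SS x = (Real.sqrt x : ℂ) := by
  unfold SS
  rw [← Complex.ofReal_log hx.le, show ((Real.log x : ℝ) : ℂ) / 2 = ((Real.log x / 2 : ℝ) : ℂ) by push_cast; rfl,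
    ← Complex.ofReal_exp, Real.exp_half, Real.exp_log hx]

lemma MM_norm {a : ℝ} (ha : 0 < a) (s : ℂ) (v : ℝ × ℝ) : ‖MM a s v‖ ≤ 1 := by
  unfold MM
  rw [Complex.norm_exp, Real.exp_le_one_iff, ← Complex.ofReal_neg, Complex.re_ofReal_mul]
  have := SS_re (((v.1 ^ 2 + v.2 ^ 2 : ℝ) : ℂ) + s ^ 2)
  nlinarith

lemma slit {s : ℂ} (hs : 0 < s.re) (t : ℝ) (ht : 0 ≤ t) : (t : ℂ) + s ^ 2 ∈ Complex.slitPlane := by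
  rw [Complex.mem_slitPlane_iff]
  simp only [sq, Complex.add_re, Complex.mul_re, Complex.add_im, Complex.mul_im, Complex.ofReal_re, Complex.ofReal_im]
  by_cases h : s.im = 0
  · left; rw [h]; nlinarith
  · right
    have := mul_ne_zero hs.ne' h
    intro h2; apply this; linarith

lemma MM_diff {a : ℝ} (v : ℝ × ℝ) : DifferentiableOn ℂ (fun s => MM a s v) {s | 0 < s.re} := by
  intro s hs
  apply DifferentiableAt.differentiableWithinAt
  unfold MM SS
  have h1 : DifferentiableAt ℂ (fun s : ℂ => Complex.log (((v.1 ^ 2 + v.2 ^ 2 : ℝ) : ℂ) + s ^ 2)) s := by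
    refine DifferentiableAt.clog (by fun_prop) (slit hs _ (by positivity))
  fun_prop

lemma MM_meas (a : ℝ) (s : ℂ) : Measurable (MM a s) := by
  unfold MM SS
  have : Measurable fun v : ℝ × ℝ => Complex.log (((v.1 ^ 2 + v.2 ^ 2 : ℝ) : ℂ) + s ^ 2) := by
    refine Complex.measurable_log.comp ?_
    fun_prop
  fun_prop

lemma MM_real {a s : ℝ} (hs : 0 < s) (v : ℝ × ℝ) : MM a s v =
    ((Real.exp (-(a * Real.sqrt (v.1 ^ 2 + v.2 ^ 2 + s ^ 2))) : ℝ) : ℂ) := by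
  unfold MM
  rw [← Complex.ofReal_pow, ← Complex.ofReal_add, SS_ofReal (by positivity)]
  push_cast
  congr 1; ring

lemma continuous_rr (a : ℝ) : Continuous (rr a) := by
  unfold rr; fun_prop

lemma GG_meas (a : ℝ) (s : ℂ) : Measurable (GG a s) := by
  have := (continuous_rr a).measurable
  unfold GG
  fun_prop

lemma GG_diff (a : ℝ) (z : ℝ × ℝ) : Differentiable ℂ (fun s => GG a s z) := by
  unfold GG
  fun_prop

lemma GG_norm {a : ℝ} (ha : 0 < a) {s : ℂ} (hs : 0 ≤ s.re) (z : ℝ × ℝ) :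
    ‖GG a s z‖ ≤ 1 / a ^ 2 + 1 / a * ‖s‖ := by
  have hr := rr_pos ha z
  have har : a ≤ rr a z := by
    unfold rr; apply Real.le_sqrt_of_sq_le; nlinarith [sq_nonneg z.1, sq_nonneg z.2]
  unfold GG
  rw [norm_div, norm_mul, norm_mul, norm_mul, norm_mul, norm_pow, Complex.norm_real, Complex.norm_real,
    Complex.norm_real, Real.norm_of_nonneg ha.le, Real.norm_of_nonneg hr.le,
    Real.norm_of_nonneg Real.pi_pos.le, Complex.norm_exp]
  generalize rr a z = r at *
  have h1 : ‖1 + s * (r:ℂ)‖ ≤ 1 + ‖s‖ * r := by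
    refine (norm_add_le _ _).trans ?_
    rw [norm_mul, Complex.norm_real, Real.norm_of_nonneg hr.le, norm_one]
  have h2 : Real.exp ((-s * (r:ℂ)).re) ≤ 1 := by
    rw [Real.exp_le_one_iff]
    simp
    positivity
  have h3 : 1 ≤ 2 * Real.pi := by have := Real.pi_gt_three; linarith
  simp only [Complex.norm_ofNat]
  calc a * ‖1 + s * (r:ℂ)‖ * Real.exp ((-s * (r:ℂ)).re) / (2 * Real.pi * r ^ 3)
      ≤ a * (1 + ‖s‖ * r) * 1 / (1 * r ^ 3) := by gcongr
    _ = a / (r * r ^ 2) + a * ‖s‖ / (r * r) := by field_simp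
    _ ≤ a / (a * a ^ 2) + a * ‖s‖ / (a * a) := by gcongr
    _ = _ := by field_simp

lemma diff_integral {f : ℂ → (ℝ × ℝ) → ℂ} {h : ℝ × ℝ → ℂ} (hh : Integrable h) {A B : ℝ}
    (hB : 0 ≤ B)
    (hm : ∀ s, Measurable (f s)) (hd : ∀ x, DifferentiableOn ℂ (fun s => f s x) {s | 0 < s.re})
    (hb : ∀ s : ℂ, 0 < s.re → ∀ x, ‖f s x‖ ≤ A + B * ‖s‖) :
    DifferentiableOn ℂ (fun s => ∫ x, f s x * h x) {s | 0 < s.re} := by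
  intro s₀ hs₀
  have hs₀ : 0 < s₀.re := hs₀
  have hopen : IsOpen {s : ℂ | 0 < s.re} := isOpen_lt continuous_const Complex.continuous_re
  have hda : ∀ x, ∀ s : ℂ, 0 < s.re → DifferentiableAt ℂ (fun s => f s x) s := fun x s hs =>
    (hd x).differentiableAt (hopen.mem_nhds hs)
  set ρ := s₀.re / 4 with hρ
  have hρ0 : 0 < ρ := by positivity
  have hre : ∀ s ∈ Metric.ball s₀ ρ, ∀ w ∈ Metric.closedBall s ρ, 0 < w.re ∧ ‖w‖ ≤ ‖s₀‖ + 2 * ρ := by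
    intro s hs w hw
    have h1 : ‖w - s₀‖ ≤ 2 * ρ := by
      have h2 : ‖s - s₀‖ < ρ := mem_ball_iff_norm.1 hs
      have h3 : ‖w - s‖ ≤ ρ := mem_closedBall_iff_norm.1 hw
      have := norm_add_le (w - s) (s - s₀)
      rw [sub_add_sub_cancel] at this
      linarith
    constructor
    · have := (Complex.abs_re_le_norm (w - s₀)).trans h1
      rw [Complex.sub_re, abs_le] at this
      linarith
    · have := norm_add_le (w - s₀) s₀
      rw [sub_add_cancel] at this
      linarith
  set C := A + B * (‖s₀‖ + 2 * ρ) with hC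
  have hfint : ∀ s : ℂ, 0 < s.re → Integrable (fun x => f s x * h x) := fun s hs =>
    hh.bdd_mul (hm s).aestronglyMeasurable (Eventually.of_forall (hb s hs))
  have key := hasDerivAt_integral_of_dominated_loc_of_deriv_le (μ := (volume : Measure (ℝ × ℝ)))
    (F := fun s x => f s x * h x) (F' := fun s x => deriv (fun s => f s x) s * h x)
    (x₀ := s₀) (s := Metric.ball s₀ ρ) (bound := fun x => C / ρ * ‖h x‖)
    (Metric.ball_mem_nhds _ hρ0)
    (Eventually.of_forall fun s => (hm s).aestronglyMeasurable.mul hh.aestronglyMeasurable)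
    (hfint s₀ hs₀)
    (by
      refine AEStronglyMeasurable.mul ?_ hh.aestronglyMeasurable
      refine aestronglyMeasurable_of_tendsto_ae (𝓝[≠] s₀) (f := fun s x => slope (fun s => f s x) s₀ s) ?_ ?_
      · intro s
        simp only [slope_def_field]
        exact (((hm s).sub (hm s₀)).div_const _).aestronglyMeasurable
      · exact Eventually.of_forall fun x => (hda x s₀ hs₀).hasDerivAt.tendsto_slope)
    (Eventually.of_forall fun x s hs => by
      rw [norm_mul]
      refine mul_le_mul_of_nonneg_right ?_ (norm_nonneg _)
      refine Complex.norm_deriv_le_of_forall_mem_sphere_norm_le hρ0 ?_ ?_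
      · refine DifferentiableOn.diffContOnCl ?_
        rw [closure_ball _ hρ0.ne']
        exact (hd x).mono fun w hw => (hre s hs w hw).1
      · intro w hw
        have := hre s hs w (Metric.sphere_subset_closedBall hw)
        refine (hb w this.1 x).trans ?_
        rw [hC]
        gcongr
        exact this.2)
    (hh.norm.const_mul _)
    (Eventually.of_forall fun x s hs =>
      (hda x s (hre s hs s (Metric.mem_closedBall_self hρ0.le)).1).hasDerivAt.mul_const _)
  exact key.2.differentiableAt.differentiableWithinAt

lemma complex_identity {a : ℝ} (ha : 0 < a) {h : ℝ × ℝ → ℂ} (hh : Integrable h)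
    (hh2 : Integrable (fun z => ∫ v, h v * ee z v)) {s : ℂ} (hs : 0 < s.re) :
    ∫ z, GG a s z * (∫ v, h v * ee z v) = ∫ v, MM a s v * h v := by
  have hopen : IsOpen {s : ℂ | 0 < s.re} := isOpen_lt continuous_const Complex.continuous_re
  have h1 := (diff_integral (f := GG a) hh2 (A := 1 / a ^ 2) (B := 1 / a) (by positivity) (GG_meas a)
    (fun x => (GG_diff a x).differentiableOn) (fun s hs => GG_norm ha hs.le)).analyticOnNhd hopen
  have h2 := (diff_integral (f := MM a) hh (A := 1) (B := 0) le_rfl (MM_meas a)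
    (fun x => MM_diff x) (fun s hs x => by simpa using MM_norm ha s x)).analyticOnNhd hopen
  refine h1.eqOn_of_preconnected_of_frequently_eq h2 (convex_halfSpace_re_gt 0).isPreconnected
    (z₀ := 1) (by simp) ?_ hs
  have ht : Tendsto (fun t : ℝ => (t : ℂ)) (𝓝[≠] 1) (𝓝[≠] 1) := by
    refine tendsto_nhdsWithin_of_tendsto_nhds_of_eventually_within _ ?_ ?_
    · have := Complex.continuous_ofReal.tendsto 1
      rw [Complex.ofReal_one] at this
      exact this.mono_left nhdsWithin_le_nhds
    · filter_upwards [self_mem_nhdsWithin] with t ht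
      simpa using ht
  refine ht.frequently (Eventually.frequently ?_)
  have : ∀ᶠ t : ℝ in 𝓝[≠] 1, 0 < t := nhdsWithin_le_nhds (lt_mem_nhds one_pos)
  filter_upwards [this] with t ht
  rw [real_identity ha ht hh]
  simp_rw [MM_real ht]

noncomputable def sk (k ε : ℝ) : ℂ := (ε : ℂ) - Complex.I * k

lemma sk_tendsto (k : ℝ) : Tendsto (sk k) (𝓝[>] 0) (𝓝 (-(Complex.I * k))) := by
  have : Continuous (sk k) := by unfold sk; fun_prop
  have := this.tendsto 0
  simp only [sk, Complex.ofReal_zero, zero_sub] at this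
  exact this.mono_left nhdsWithin_le_nhds

lemma MM_limit {k : ℝ} (hk : 0 < k) (b : ℝ) (v : ℝ × ℝ) :
    Tendsto (fun ε => MM (-b) (sk k ε) v) (𝓝[>] 0) (𝓝 (Complex.exp (-Complex.I * kappa k v * (b : ℂ)))) := by
  set T := v.1 ^ 2 + v.2 ^ 2 with hT
  set x : ℝ → ℂ := fun ε => (T : ℂ) + sk k ε ^ 2 with hx
  have hxl : Tendsto x (𝓝[>] 0) (𝓝 ((T - k ^ 2 : ℝ) : ℂ)) := by
    have := ((sk_tendsto k).pow 2).const_add (T : ℂ)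
    convert this using 2
    push_cast
    rw [neg_sq, mul_pow, Complex.I_sq]; ring
  have hmain : ∀ w : ℂ, w = -Complex.I * kappa k v → Tendsto (fun ε => SS (x ε)) (𝓝[>] 0) (𝓝 w) →
      Tendsto (fun ε => MM (-b) (sk k ε) v) (𝓝[>] 0) (𝓝 (Complex.exp (-Complex.I * kappa k v * (b : ℂ)))) := by
    intro w hw h
    rw [← hw]
    have := (h.const_mul (b : ℂ)).cexp
    rw [mul_comm w]
    refine this.congr fun ε => ?_
    unfold MM
    simp [hx, hT]
  have hne : ∀ᶠ ε in 𝓝[>] (0:ℝ), x ε ≠ 0 := by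
    filter_upwards [self_mem_nhdsWithin] with ε hε
    have hε : 0 < ε := hε
    exact Complex.slitPlane_ne_zero (slit (by simpa [sk] using hε) _ (by positivity))
  rcases lt_trichotomy T (k ^ 2) with h | h | h
  · refine hmain (-Complex.I * (Real.sqrt (k ^ 2 - T) : ℂ)) ?_ ?_
    · unfold kappa
      rw [if_pos h.le, sub_sub]
    · have h1 : Tendsto x (𝓝[>] 0) (𝓝[{z : ℂ | z.im < 0}] ((T - k ^ 2 : ℝ) : ℂ)) := by
        refine tendsto_nhdsWithin_of_tendsto_nhds_of_eventually_within _ hxl ?_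
        filter_upwards [self_mem_nhdsWithin] with ε hε
        have hε : 0 < ε := hε
        simp [hx, sk, sq]
        nlinarith [mul_pos hε hk]
      have h2 := Complex.tendsto_log_nhdsWithin_im_neg_of_re_neg_of_im_zero
        (z := ((T - k ^ 2 : ℝ) : ℂ)) (by rw [Complex.ofReal_re]; linarith) (Complex.ofReal_im _)
      have h3 := ((h2.comp h1).div_const 2).cexp
      refine (Eq.subst (motive := fun w => Tendsto (fun ε => SS (x ε)) (𝓝[>] 0) (𝓝 w)) ?_ h3)
      rw [Complex.norm_real, Real.norm_of_nonpos (by linarith), neg_sub, sub_div, Complex.exp_sub,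
        show (Real.pi : ℂ) * Complex.I / 2 = (Real.pi : ℂ) / 2 * Complex.I by ring, Complex.exp_pi_div_two_mul_I,
        Complex.div_I]
      have := SS_ofReal (x := k ^ 2 - T) (by linarith)
      unfold SS at this
      rw [Complex.ofReal_log (by linarith), this]; ring
  · refine hmain 0 ?_ ?_
    · unfold kappa
      rw [if_pos h.le, sub_sub, ← hT, h]
      simp
    · rw [tendsto_zero_iff_norm_tendsto_zero]
      have h1 : Tendsto (fun ε => Real.sqrt ‖x ε‖) (𝓝[>] 0) (𝓝 (Real.sqrt ‖((T - k ^ 2 : ℝ) : ℂ)‖)) :=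
        hxl.norm.sqrt
      rw [h] at h1
      simp only [sub_self, Complex.ofReal_zero, norm_zero, Real.sqrt_zero] at h1
      refine h1.congr' ?_
      filter_upwards [hne] with ε hε
      exact (SS_norm hε).symm
  · refine hmain (Real.sqrt (T - k ^ 2) : ℂ) ?_ ?_
    · unfold kappa
      rw [if_neg (by rw [← hT]; linarith), ← hT]
      rw [← mul_assoc]; simp
    · rw [← SS_ofReal (by linarith)]
      unfold SS
      refine ((hxl.clog ?_).div_const 2).cexp
      rw [Complex.ofReal_mem_slitPlane]; linarith

lemma GG_eq (k b : ℝ) (z : ℝ × ℝ) : GG (-b) (-(Complex.I * k)) z = - Kker k b z := by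
  unfold GG Kker rr
  rw [neg_sq, neg_neg]
  push_cast
  ring

lemma Kker_meas (k b : ℝ) : Measurable (Kker k b) := by
  have h : Kker k b = fun z => - GG (-b) (-(Complex.I * k)) z := by ext z; rw [GG_eq, neg_neg]
  rw [h]
  exact (GG_meas _ _).neg

lemma Kker_norm {k b : ℝ} (hk : 0 < k) (hb : b < 0) (z : ℝ × ℝ) : ‖Kker k b z‖ ≤ 1 / b ^ 2 + 1 / (-b) * k := by
  have := GG_norm (a := -b) (by linarith) (s := -(Complex.I * k)) (by simp) z
  rw [GG_eq, norm_neg] at this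
  simpa [abs_of_pos hk] using this

lemma core {k b : ℝ} (hk : 0 < k) (hb : b < 0) {h : ℝ × ℝ → ℂ} (hh : Integrable h)
    (hh2 : Integrable (fun z => ∫ v, h v * ee z v)) :
    ∫ z, - Kker k b z * (∫ v, h v * ee z v) =
      ∫ v, Complex.exp (-Complex.I * kappa k v * (b : ℂ)) * h v := by
  have ha : 0 < -b := by linarith
  have h1 : Tendsto (fun ε => ∫ z, GG (-b) (sk k ε) z * (∫ v, h v * ee z v)) (𝓝[>] 0)
      (𝓝 (∫ z, - Kker k b z * (∫ v, h v * ee z v))) := by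
    refine tendsto_integral_filter_of_dominated_convergence
      (fun z => (1 / (-b) ^ 2 + 1 / (-b) * (1 + k)) * ‖∫ v, h v * ee z v‖) ?_ ?_ (hh2.norm.const_mul _) ?_
    · exact Eventually.of_forall fun ε => (GG_meas _ _).aestronglyMeasurable.mul hh2.aestronglyMeasurable
    · have : ∀ᶠ ε in 𝓝[>] (0:ℝ), ε < 1 := nhdsWithin_le_nhds (gt_mem_nhds one_pos)
      filter_upwards [self_mem_nhdsWithin, this] with ε hε hε1
      have hε : 0 < ε := hε
      refine Eventually.of_forall fun z => ?_
      rw [norm_mul]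
      refine mul_le_mul_of_nonneg_right ?_ (norm_nonneg _)
      refine (GG_norm ha (by simpa [sk] using hε.le) z).trans ?_
      gcongr
      unfold sk
      refine (norm_sub_le _ _).trans ?_
      simp [abs_of_pos hk, abs_of_pos hε]
      exact hε1.le
    · refine Eventually.of_forall fun z => Tendsto.mul_const _ ?_
      rw [← GG_eq]
      exact ((GG_diff (-b) z).continuous.tendsto _).comp (sk_tendsto k)
  have h2 : Tendsto (fun ε => ∫ v, MM (-b) (sk k ε) v * h v) (𝓝[>] 0)
      (𝓝 (∫ v, Complex.exp (-Complex.I * kappa k v * (b : ℂ)) * h v)) := by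
    refine tendsto_integral_filter_of_dominated_convergence
      (fun z => ‖h z‖) ?_ ?_ hh.norm ?_
    · exact Eventually.of_forall fun ε => (MM_meas _ _).aestronglyMeasurable.mul hh.aestronglyMeasurable
    · refine Eventually.of_forall fun ε => Eventually.of_forall fun z => ?_
      rw [norm_mul]
      exact mul_le_of_le_one_left (norm_nonneg _) (MM_norm ha _ _)
    · exact Eventually.of_forall fun v => (MM_limit hk b v).mul_const _
  refine tendsto_nhds_unique (h1.congr' ?_) h2
  filter_upwards [self_mem_nhdsWithin] with ε hε
  have hε : 0 < ε := hε
  exact complex_identity ha hh hh2 (by simpa [sk] using hε)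


lemma BigPsi_eq (ψ : SchwartzMap (ℝ × ℝ) ℂ) (x : ℝ × ℝ) : BigPsi ψ x = ∫ v, ψ v * ee x v := rfl

lemma BigPsi_integrable (ψ : SchwartzMap (ℝ × ℝ) ℂ) : Integrable (BigPsi ψ) := by
  let L := WithLp.prodContinuousLinearEquiv 2 ℝ ℝ ℝ
  let ψ' : SchwartzMap (WithLp 2 (ℝ × ℝ)) ℂ := SchwartzMap.compCLMOfContinuousLinearEquiv ℂ L ψ
  have h1 : Integrable (FourierTransform.fourier ψ') := SchwartzMap.integrable _
  have hmp := WithLp.volume_preserving_toLp ℝ ℝ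
  have h2 := hmp.integrable_comp_of_integrable h1
  have h3 : ((FourierTransform.fourier ψ' : SchwartzMap (WithLp 2 (ℝ × ℝ)) ℂ) ∘ WithLp.toLp 2 : ℝ × ℝ → ℂ) =
      fun x => BigPsi ψ ((2 * Real.pi) • x) := by
    ext x
    rw [Function.comp_apply, SchwartzMap.fourier_coe, Real.fourier_eq', BigPsi_eq]
    rw [← hmp.integral_comp (MeasurableEquiv.toLp 2 (ℝ × ℝ)).measurableEmbedding]
    congr 1
    ext v
    rw [smul_eq_mul, mul_comm]
    congr 1
    unfold ee
    congr 1
    simp [WithLp.prod_inner_apply]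
    ring
  rw [h3] at h2
  exact (integrable_comp_smul_iff volume (BigPsi ψ) (by positivity)).1 h2

lemma kappa_meas (k : ℝ) : Measurable (kappa k) := by
  unfold kappa
  refine Measurable.ite ?_ ?_ ?_
  · exact measurableSet_le (by fun_prop) (by fun_prop)
  · fun_prop
  · fun_prop

lemma mult_norm (k : ℝ) {b : ℝ} (hb : b < 0) (v : ℝ × ℝ) :
    ‖Complex.exp (-Complex.I * kappa k v * (b : ℂ))‖ ≤ 1 := by
  rw [Complex.norm_exp, Real.exp_le_one_iff]
  unfold kappa
  split_ifs
  · simp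
  · have : 0 ≤ Real.sqrt (v.1 ^ 2 + v.2 ^ 2 - k ^ 2) := Real.sqrt_nonneg _
    simp
    nlinarith

/-- The tempered-distribution Fourier transform of the double-layer
potential with bounded, compactly supported density `φ`, evaluated on the plane
`{x₃ = b}`, equals `φ̂(v) e^{−iκ(v) b}`. -/
theorem fourier_transform_of_double_layer_potential
    (k b : ℝ) (hk : 0 < k) (hb : b < 0) (φ : ℝ × ℝ → ℂ)
    (hφm : Measurable φ) (hφb : ∃ C : ℝ, ∀ x : ℝ × ℝ, ‖φ x‖ ≤ C)
    (hφc : HasCompactSupport φ) (ψ : SchwartzMap (ℝ × ℝ) ℂ) :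
    Integrable (fun x : ℝ × ℝ => doubleLayer k b φ x * BigPsi ψ x) (volume : Measure (ℝ × ℝ)) ∧
    Integrable (fun v : ℝ × ℝ =>
      fourierT φ v * Complex.exp (-Complex.I * kappa k v * (b : ℂ)) * ψ v)
      (volume : Measure (ℝ × ℝ)) ∧
    ∫ x : ℝ × ℝ, doubleLayer k b φ x * BigPsi ψ x =
      ∫ v : ℝ × ℝ, fourierT φ v * Complex.exp (-Complex.I * kappa k v * (b : ℂ)) * ψ v := by
  obtain ⟨C, hC⟩ := hφb
  have hφi : Integrable φ := by
    refine (integrableOn_iff_integrable_of_support_subset (subset_tsupport φ)).1 ?_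
    exact Measure.integrableOn_of_bounded hφc.isCompact.measure_lt_top.ne hφm.aestronglyMeasurable
      (Eventually.of_forall hC)
  have hΨ := BigPsi_integrable ψ
  have hψ : Integrable ψ := ψ.integrable
  have hJ : Integrable (Function.uncurry fun x y : ℝ × ℝ =>
      -Kker k b (x - y) * (φ y * BigPsi ψ x)) (volume.prod volume) := by
    refine Integrable.bdd_mul (c := 1 / b ^ 2 + 1 / (-b) * k) ?_ ?_ ?_
    · refine (hΨ.mul_prod hφi).congr (Eventually.of_forall fun p => ?_)
      exact mul_comm _ _
    · exact ((Kker_meas k b).neg.comp (measurable_fst.sub measurable_snd)).aestronglyMeasurable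
    · refine Eventually.of_forall fun p => ?_
      rw [norm_neg]
      exact Kker_norm hk hb _
  have hdl : ∀ x, doubleLayer k b φ x * BigPsi ψ x = ∫ y, -Kker k b (x - y) * (φ y * BigPsi ψ x) := by
    intro x
    unfold doubleLayer
    rw [← integral_neg, ← integral_mul_const]
    congr 1; ext y
    rw [show ((x.1 - y.1, x.2 - y.2) : ℝ × ℝ) = x - y from rfl]
    ring
  set m : ℝ × ℝ → ℂ := fun v => Complex.exp (-Complex.I * kappa k v * (b : ℂ)) with hm
  have hmm : Measurable m := by
    have := kappa_meas k
    rw [hm]; fun_prop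
  have hmψ : Integrable (fun v => m v * ψ v) :=
    hψ.bdd_mul hmm.aestronglyMeasurable (Eventually.of_forall (mult_norm k hb))
  have hJ2 : Integrable (Function.uncurry fun y v : ℝ × ℝ => φ y * (m v * ψ v) * ee y v)
      (volume.prod volume) := by
    refine (hφi.mul_prod hmψ).mul_bdd (c := 1) ?_ ?_
    · exact continuous_ee.aestronglyMeasurable
    · exact Eventually.of_forall fun p => (norm_ee _ _).le
  have hft : ∀ v, fourierT φ v * m v * ψ v = ∫ y, φ y * (m v * ψ v) * ee y v := by
    intro v
    unfold fourierT
    rw [mul_assoc, ← integral_mul_const]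
    congr 1; ext y
    unfold ee
    ring
  have hy : ∀ y, ∫ x, -Kker k b (x - y) * (φ y * BigPsi ψ x) = ∫ v, φ y * (m v * ψ v) * ee y v := by
    intro y
    have hsh : ∀ z, BigPsi ψ (z + y) = ∫ v, (ψ v * ee y v) * ee z v := by
      intro z
      rw [BigPsi_eq]
      congr 1; ext v
      unfold ee
      rw [mul_assoc, ← Complex.exp_add]
      congr 2
      simp only [Prod.fst_add, Prod.snd_add]
      push_cast
      ring
    have hc := core hk hb (h := fun v => ψ v * ee y v)
      (hψ.mul_bdd (c := 1) (continuous_ee.comp (continuous_const.prodMk continuous_id)).aestronglyMeasurable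
        (Eventually.of_forall fun v => (norm_ee _ _).le))
      (by simp_rw [← hsh]; exact hΨ.comp_add_right y)
    simp_rw [← hsh] at hc
    rw [← integral_add_right_eq_self _ y]
    simp_rw [add_sub_cancel_right]
    calc _ = φ y * ∫ z, -Kker k b z * BigPsi ψ (z + y) := by
          rw [← integral_const_mul]; congr 1; ext z; ring
      _ = _ := by
          rw [hc, ← integral_const_mul]; congr 1; ext v; ring
  refine ⟨?_, ?_, ?_⟩
  · simp_rw [hdl]
    exact hJ.integral_prod_left
  · change Integrable (fun v => fourierT φ v * m v * ψ v) volume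
    simp_rw [hft]
    exact hJ2.integral_prod_right
  · change _ = ∫ v, fourierT φ v * m v * ψ v
    simp_rw [hdl, hft]
    rw [integral_integral_swap hJ, ← integral_integral_swap hJ2]
    simp_rw [hy]
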